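/- Let I_n be a finite index set of size n and let M = (M_{ij})_{i,j∈I_n} be a real n×n matrix. If there exists a diamond-colored distributive lattice L whose edge-coloring function onto I_n is surjective and which has the M-structure property, then M is a generalized Cartan matrix; moreover M is then a Cartan matrix of finite type, i.e. the Coxeter group W_M determined by M is finite. -/

import Mathlib

open scoped BigOperators

noncomputable section

/-- A finite distributive lattice with each covering edge of its Hasse diagram colored by
an element of `I`, such that in every diamond of covering relations parallel edges have
the same color. -/
structure DiamondColoredDistribLattice (I : Type*) where
  V : Type
  [lat : DistribLattice V]
  [fin : Fintype V]
  edge : I → V → V → Prop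
  edge_cov : ∀ i x y, edge i x y → x ⋖ y
  cov_edge : ∀ x y : V, x ⋖ y → ∃ i, edge i x y
  edge_unique : ∀ i j x y, edge i x y → edge j x y → i = j
  diamond : ∀ (i : I) (s x y t : V), x ≠ y → s ⋖ x → s ⋖ y → x ⋖ t → y ⋖ t →
      (edge i s x ↔ edge i y t)

attribute [instance] DiamondColoredDistribLattice.lat DiamondColoredDistribLattice.fin

/-- The height of an element of a finite poset: the largest length of a chain of covering
relations ending at it.  (This is the rank function of a graded finite lattice.) -/
def heightOf {V : Type*} [Preorder V] (x : V) : ℕ :=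
  sSup {n : ℕ | ∃ g : ℕ → V, g n = x ∧ ∀ k < n, g k ⋖ g (k + 1)}

namespace DiamondColoredDistribLattice

variable {I : Type*} (L : DiamondColoredDistribLattice I)

/-- The `i`-component of `x`: the connected component of `x` in the subgraph of the Hasse
diagram retaining only color-`i` edges. -/
def comp (i : I) (x : L.V) : Set L.V :=
  {y | Relation.ReflTransGen (fun a b => L.edge i a b ∨ L.edge i b a) x y}

/-- `ρ_i(x)`: the rank of `x` within its `i`-component. -/
def rhoi (i : I) (x : L.V) : ℕ := heightOf x - sInf (heightOf '' L.comp i x)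

/-- `l_i(x)`: the length of the `i`-component of `x`. -/
def li (i : I) (x : L.V) : ℕ :=
  sSup (heightOf '' L.comp i x) - sInf (heightOf '' L.comp i x)

/-- `δ_i(x) = l_i(x) - ρ_i(x)`. -/
def deltai (i : I) (x : L.V) : ℕ := L.li i x - L.rhoi i x

/-- `m_i(x) = ρ_i(x) - δ_i(x)`. -/
def mi (i : I) (x : L.V) : ℤ := (L.rhoi i x : ℤ) - (L.deltai i x : ℤ)

end DiamondColoredDistribLattice

/- The entry `m_{ij}` of the Coxeter matrix determined by the product `M_{ij}M_{ji}` of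
off-diagonal entries of a generalized Cartan matrix:  `m_{ij} = 2, 3, 4, 6` according as
`M_{ij}M_{ji} = 0, 1, 2, 3`, and `m_{ij} = ∞` (encoded by `0`, meaning no relation) for
`M_{ij}M_{ji} ≥ 4`. -/
open Classical in
def coxeterExponent (p : ℝ) : ℕ :=
  if p = 0 then 2 else if p = 1 then 3 else if p = 2 then 4 else if p = 3 then 6 else 0

/- The Coxeter relations `s_i² = 1` and `(s_i s_j)^{m_{ij}} = 1` determined by the matrix
`M`. -/
open Classical in
def coxeterRelations {I : Type*} (M : I → I → ℝ) : Set (FreeGroup I) :=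
  {r | ∃ i j : I, r = (FreeGroup.of i * FreeGroup.of j) ^
        (if i = j then 1 else coxeterExponent (M i j * M j i))}

/-- The Coxeter group `W_M` determined by the matrix `M`, as a presented group. -/
def coxeterGroupOf {I : Type*} (M : I → I → ℝ) : Type _ :=
  PresentedGroup (coxeterRelations M)

instance {I : Type*} (M : I → I → ℝ) : Group (coxeterGroupOf M) :=
  inferInstanceAs (Group (PresentedGroup (coxeterRelations M)))

/-! ### Finiteness of the Coxeter group from a finite regular orbit -/

section NumbersGame

variable {I : Type*}

/-- The image of the generator `s_i` in the Coxeter group. -/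
def coxeterGen (M : I → I → ℝ) (i : I) : coxeterGroupOf M :=
  PresentedGroup.of (rels := coxeterRelations M) i

theorem coxeterGen_mul_self (M : I → I → ℝ) (i : I) :
    coxeterGen M i * coxeterGen M i = 1 :=
  PresentedGroup.one_of_mem (rels := coxeterRelations M) (x := FreeGroup.of i * FreeGroup.of i)
    ⟨i, i, by simp⟩

theorem coxeterGen_inv (M : I → I → ℝ) (i : I) : (coxeterGen M i)⁻¹ = coxeterGen M i :=
  inv_eq_of_mul_eq_one_left (coxeterGen_mul_self M i)

theorem coxeterGen_mul_pow (M : I → I → ℝ) {i j : I} (hij : i ≠ j) :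
    (coxeterGen M i * coxeterGen M j) ^ coxeterExponent (M i j * M j i) = 1 :=
  PresentedGroup.one_of_mem (rels := coxeterRelations M)
    (x := (FreeGroup.of i * FreeGroup.of j) ^ coxeterExponent (M i j * M j i))
    ⟨i, j, by simp [hij]⟩

/-- A nonempty finite subset of the Coxeter group stable under left multiplication by the
generators forces the group to be finite. -/
theorem finite_coxeterGroupOf_of_stable (M : I → I → ℝ) (S : Set (coxeterGroupOf M))
    (hfin : S.Finite) (hne : S.Nonempty)
    (hS : ∀ i, ∀ w ∈ S, coxeterGen M i * w ∈ S) : Finite (coxeterGroupOf M) := by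
  obtain ⟨w₀, hw₀⟩ := hne
  have hcl : ∀ g : coxeterGroupOf M, ∀ w ∈ S, g * w ∈ S := by
    intro g
    have hg : g ∈ Subgroup.closure (Set.range (coxeterGen M)) := by
      have := PresentedGroup.closure_range_of (coxeterRelations M)
      change g ∈ Subgroup.closure
        (Set.range (PresentedGroup.of : I → PresentedGroup (coxeterRelations M)))
      rw [this]
      exact Subgroup.mem_top _
    induction hg using Subgroup.closure_induction with
    | mem x hx =>
      obtain ⟨i, rfl⟩ := hx
      exact hS i
    | one => intro w hw; simpa using hw
    | mul x y _ _ hx hy => intro w hw; rw [mul_assoc]; exact hx _ (hy _ hw)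
    | inv x _ hx =>
      intro w hw
      have hmaps : Set.MapsTo (fun w => x * w) S S := hx
      obtain ⟨v, hv, hvw⟩ := (hfin.injOn_iff_bijOn_of_mapsTo hmaps).mp (mul_right_injective x).injOn |>.surjOn hw
      simpa [← hvw] using hv
  have : S = Set.univ := Set.eq_univ_of_forall fun g => by
    simpa using hcl (g * w₀⁻¹) w₀ hw₀
  exact Set.finite_univ_iff.mp (this ▸ hfin)

variable [Fintype I]

open Classical in
/-- The reflection `φ ↦ φ - (∑ k, M i k * φ k) e_i`. -/
def coordReflection (M : I → I → ℝ) (i : I) (φ : I → ℝ) : I → ℝ :=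
  φ - (M i ⬝ᵥ φ) • Pi.single i 1

/-- `GamePath M φ w` records a play of the numbers game from `φ` to a dominant vector, firing
coordinates of negative value only, together with the product `w` of the generators fired. -/
inductive GamePath (M : I → I → ℝ) : (I → ℝ) → coxeterGroupOf M → Prop
  | dominant (φ : I → ℝ) (h : ∀ i, 0 ≤ M i ⬝ᵥ φ) : GamePath M φ 1
  | fire (φ : I → ℝ) (i : I) (w : coxeterGroupOf M) (h : M i ⬝ᵥ φ < 0)
      (hw : GamePath M (coordReflection M i φ) w) : GamePath M φ (coxeterGen M i * w)

theorem sum_coordReflection (M : I → I → ℝ) (i : I) (φ : I → ℝ) :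
    ∑ k, coordReflection M i φ k = ∑ k, φ k - M i ⬝ᵥ φ := by
  classical
  simp [coordReflection, Finset.sum_sub_distrib, Pi.single_apply]

theorem dotProduct_coordReflection (M : I → I → ℝ) (i j : I) (φ : I → ℝ) :
    M j ⬝ᵥ coordReflection M i φ = M j ⬝ᵥ φ - M i ⬝ᵥ φ * M j i := by
  classical
  simp [coordReflection, dotProduct_sub]

theorem coordReflection_involutive (M : I → I → ℝ) (hdiag : ∀ i, M i i = 2) (i : I)
    (φ : I → ℝ) : coordReflection M i (coordReflection M i φ) = φ := by
  classical
  have h := dotProduct_coordReflection M i i φ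
  rw [hdiag] at h
  rw [coordReflection, h, coordReflection]
  module

/-- The action of the reflections `i` and `j` on the plane through `φ` spanned by `e_i` and
`e_j`, in coordinates. -/
theorem exists_plane_coordReflection (M : I → I → ℝ) (hdiag : ∀ i, M i i = 2) (i j : I)
    (φ : I → ℝ) :
    ∃ (P : ℝ → ℝ → I → ℝ) (A B : ℝ), A = M i ⬝ᵥ φ ∧ B = M j ⬝ᵥ φ ∧ P 0 0 = φ ∧
      (∀ x y, M i ⬝ᵥ P x y = A + 2 * x + M i j * y) ∧
      (∀ x y, M j ⬝ᵥ P x y = B + M j i * x + 2 * y) ∧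
      (∀ x y, coordReflection M i (P x y) = P (-A - x - M i j * y) y) ∧
      (∀ x y, coordReflection M j (P x y) = P x (-B - M j i * x - y)) := by
  classical
  refine ⟨fun x y => φ + x • Pi.single i 1 + y • Pi.single j 1, _, _, rfl, rfl, by simp,
    fun x y => ?_, fun x y => ?_, fun x y => ?_, fun x y => ?_⟩ <;>
    simp only [coordReflection, dotProduct_add, dotProduct_smul, dotProduct_single, hdiag,
      smul_eq_mul, mul_one]
  · ring
  · ring
  · module
  · module

/-- The off-diagonal pairs `(M i j, M j i)` of a Cartan matrix of finite type, up to order. -/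
def IsFiniteTypePair (a b : ℝ) : Prop :=
  (a = 0 ∧ b = 0) ∨ (a = -1 ∧ b = -1) ∨ (a = -1 ∧ b = -2) ∨ (a = -1 ∧ b = -3)

theorem GamePath.confluent_of_isFiniteTypePair (M : I → I → ℝ) (hdiag : ∀ i, M i i = 2)
    (Ω : Set (I → ℝ)) (hstab : ∀ i, ∀ φ ∈ Ω, coordReflection M i φ ∈ Ω)
    {i j : I} (hij : i ≠ j) (hpair : IsFiniteTypePair (M i j) (M j i))
    {φ : I → ℝ} (hφ : φ ∈ Ω) (hi : M i ⬝ᵥ φ < 0) (hj : M j ⬝ᵥ φ < 0) :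
    ∃ ψ ∈ Ω, ∀ w, GamePath M ψ w → ∃ u v, GamePath M (coordReflection M i φ) u ∧
      GamePath M (coordReflection M j φ) v ∧ coxeterGen M i * u = coxeterGen M j * v := by
  have hpow := coxeterGen_mul_pow M hij
  have hfi : ∀ ψ w, M i ⬝ᵥ ψ < 0 → GamePath M (coordReflection M i ψ) w →
      GamePath M ψ (coxeterGen M i * w) := fun ψ w h hw => .fire ψ i w h hw
  have hfj : ∀ ψ w, M j ⬝ᵥ ψ < 0 → GamePath M (coordReflection M j ψ) w →
      GamePath M ψ (coxeterGen M j * w) := fun ψ w h hw => .fire ψ j w h hw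
  have hsi := hstab i
  have hsj := hstab j
  have hai := coxeterGen_inv M i
  have hbi := coxeterGen_inv M j
  obtain ⟨P, A, B, hA, hB, hP, hvi, hvj, hri, hrj⟩ := exists_plane_coordReflection M hdiag i j φ
  rw [← hA] at hi
  rw [← hB] at hj
  clear hA hB hstab hdiag
  subst hP
  generalize coxeterGen M i = a at *
  generalize coxeterGen M j = b at *
  generalize coordReflection M i = r at *
  generalize coordReflection M j = s at *
  rcases hpair with ⟨h₁, h₂⟩ | ⟨h₁, h₂⟩ | ⟨h₁, h₂⟩ | ⟨h₁, h₂⟩ <;>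
    simp only [h₁, h₂] at hvi hvj hri hrj hpow <;>
    norm_num [coxeterExponent] at hpow
  · have hrel : a * b = b * a := by
      have : (a * b) * (a * b) = 1 := by
        rw [← hpow]; simp only [pow_succ, pow_zero, one_mul, mul_assoc]
      simpa [hai, hbi] using eq_inv_of_mul_eq_one_left this
    refine ⟨s (r (P 0 0)), hsj _ (hsi _ hφ), fun w hw =>
      ⟨b * w, a * w, hfj _ _ ?_ hw, hfi _ _ ?_ ?_, ?_⟩⟩
    · simp only [hri, hvj]; linarith
    · simp only [hrj, hvi]; linarith
    · convert hw using 1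
      simp only [hri, hrj]
      congr 1 <;> ring
    · simp only [← mul_assoc, hrel]
  · have hrel : a * b * a = b * a * b := by
      have : (a * b * a) * (b * a * b) = 1 := by
        rw [← hpow]; simp only [pow_succ, pow_zero, one_mul, mul_assoc]
      simpa [hai, hbi, mul_assoc] using eq_inv_of_mul_eq_one_left this
    refine ⟨r (s (r (P 0 0))), hsi _ (hsj _ (hsi _ hφ)), fun w hw =>
      ⟨b * (a * w), a * (b * w), hfj _ _ ?_ (hfi _ _ ?_ hw), hfi _ _ ?_ (hfj _ _ ?_ ?_), ?_⟩⟩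
    · simp only [hri, hvj]; linarith
    · simp only [hri, hrj, hvi]; linarith
    · simp only [hrj, hvi]; linarith
    · simp only [hri, hrj, hvj]; linarith
    · convert hw using 1
      simp only [hri, hrj]
      congr 1 <;> ring
    · simp only [← mul_assoc, hrel]
  · have hrel : a * b * a * b = b * a * b * a := by
      have : (a * b * a * b) * (a * b * a * b) = 1 := by
        rw [← hpow]; simp only [pow_succ, pow_zero, one_mul, mul_assoc]
      simpa [hai, hbi, mul_assoc] using eq_inv_of_mul_eq_one_left this
    refine ⟨s (r (s (r (P 0 0)))), hsj _ (hsi _ (hsj _ (hsi _ hφ))), fun w hw =>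
      ⟨b * (a * (b * w)), a * (b * (a * w)), hfj _ _ ?_ (hfi _ _ ?_ (hfj _ _ ?_ hw)),
        hfi _ _ ?_ (hfj _ _ ?_ (hfi _ _ ?_ ?_)), ?_⟩⟩
    · simp only [hri, hvj]; linarith
    · simp only [hri, hrj, hvi]; linarith
    · simp only [hri, hrj, hvj]; linarith
    · simp only [hrj, hvi]; linarith
    · simp only [hri, hrj, hvj]; linarith
    · simp only [hri, hrj, hvi]; linarith
    · convert hw using 1
      simp only [hri, hrj]
      congr 1 <;> ring
    · simp only [← mul_assoc, hrel]
  · have hrel : a * b * a * b * a * b = b * a * b * a * b * a := by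
      have : (a * b * a * b * a * b) * (a * b * a * b * a * b) = 1 := by
        rw [← hpow]; simp only [pow_succ, pow_zero, one_mul, mul_assoc]
      simpa [hai, hbi, mul_assoc] using eq_inv_of_mul_eq_one_left this
    refine ⟨s (r (s (r (s (r (P 0 0)))))), hsj _ (hsi _ (hsj _ (hsi _ (hsj _ (hsi _ hφ))))),
      fun w hw => ⟨b * (a * (b * (a * (b * w)))), a * (b * (a * (b * (a * w)))),
        hfj _ _ ?_ (hfi _ _ ?_ (hfj _ _ ?_ (hfi _ _ ?_ (hfj _ _ ?_ hw)))),
        hfi _ _ ?_ (hfj _ _ ?_ (hfi _ _ ?_ (hfj _ _ ?_ (hfi _ _ ?_ ?_)))), ?_⟩⟩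
    · simp only [hri, hvj]; linarith
    · simp only [hri, hrj, hvi]; linarith
    · simp only [hri, hrj, hvj]; linarith
    · simp only [hri, hrj, hvi]; linarith
    · simp only [hri, hrj, hvj]; linarith
    · simp only [hrj, hvi]; linarith
    · simp only [hri, hrj, hvj]; linarith
    · simp only [hri, hrj, hvi]; linarith
    · simp only [hri, hrj, hvj]; linarith
    · simp only [hri, hrj, hvi]; linarith
    · convert hw using 1
      simp only [hri, hrj]
      congr 1 <;> ring
    · simp only [← mul_assoc, hrel]

/-- A matrix whose off-diagonal pairs are of finite type and whose reflections preserve a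
nonempty finite set of regular vectors has a finite Coxeter group. -/
theorem finite_coxeterGroupOf_of_regular (M : I → I → ℝ) (hdiag : ∀ i, M i i = 2)
    (hpair : ∀ i j, i ≠ j →
      IsFiniteTypePair (M i j) (M j i) ∨ IsFiniteTypePair (M j i) (M i j))
    (Ω : Set (I → ℝ)) (hfin : Ω.Finite) (hne : Ω.Nonempty)
    (hstab : ∀ i, ∀ φ ∈ Ω, coordReflection M i φ ∈ Ω)
    (hreg : ∀ i, ∀ φ ∈ Ω, M i ⬝ᵥ φ ≠ 0) : Finite (coxeterGroupOf M) := by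
  have hind : ∀ p : (I → ℝ) → Prop,
      (∀ φ ∈ Ω, (∀ i, M i ⬝ᵥ φ < 0 → p (coordReflection M i φ)) → p φ) → ∀ φ ∈ Ω, p φ := by
    intro p hp φ hφ
    have hwf : Ω.WellFoundedOn (fun φ ψ => ∑ k, ψ k < ∑ k, φ k) := by
      have : IsStrictOrder (I → ℝ) (fun φ ψ => ∑ k, ψ k < ∑ k, φ k) :=
        { irrefl := fun _ => lt_irrefl _, trans := fun _ _ _ h₁ h₂ => h₂.trans h₁ }
      exact hfin.wellFoundedOn
    refine hwf.induction hφ (P := p) fun ψ hψ ih => hp ψ hψ fun i hi => ih _ (hstab i ψ hψ) ?_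
    rw [sum_coordReflection]
    linarith
  have hex : ∀ φ ∈ Ω, ∃ w, GamePath M φ w := by
    refine hind _ fun φ _ ih => ?_
    by_cases h : ∀ i, 0 ≤ M i ⬝ᵥ φ
    · exact ⟨1, .dominant φ h⟩
    · push Not at h
      obtain ⟨i, hi⟩ := h
      obtain ⟨w, hw⟩ := ih i hi
      exact ⟨_, .fire φ i w hi hw⟩
  have huniq : ∀ φ ∈ Ω, ∀ w w', GamePath M φ w → GamePath M φ w' → w = w' := by
    refine hind _ fun φ hφ ih w w' hw hw' => ?_
    cases hw with
    | dominant _ h =>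
      cases hw' with
      | dominant _ _ => rfl
      | fire _ i _ hi _ => exact absurd (h i) (not_le.mpr hi)
    | fire _ i u hi hu =>
      cases hw' with
      | dominant _ h => exact absurd (h i) (not_le.mpr hi)
      | fire _ j v hj hv =>
        rcases eq_or_ne i j with rfl | hij
        · rw [ih i hi u v hu hv]
        rcases hpair i j hij with h | h
        · obtain ⟨ψ, hψ, hc⟩ :=
            GamePath.confluent_of_isFiniteTypePair M hdiag Ω hstab hij h hφ hi hj
          obtain ⟨x, hx⟩ := hex ψ hψ
          obtain ⟨u', v', hu', hv', h'⟩ := hc x hx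
          rw [ih i hi u u' hu hu', ih j hj v v' hv hv', h']
        · obtain ⟨ψ, hψ, hc⟩ :=
            GamePath.confluent_of_isFiniteTypePair M hdiag Ω hstab hij.symm h hφ hj hi
          obtain ⟨x, hx⟩ := hex ψ hψ
          obtain ⟨v', u', hv', hu', h'⟩ := hc x hx
          rw [ih i hi u u' hu hu', ih j hj v v' hv hv', h']
  choose! f hf using hex
  refine finite_coxeterGroupOf_of_stable M (f '' Ω) (hfin.image f) (hne.image f) ?_
  rintro i _ ⟨φ, hφ, rfl⟩
  have hφ' := hstab i φ hφ
  refine ⟨coordReflection M i φ, hφ', ?_⟩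
  rcases lt_or_gt_of_ne (hreg i φ hφ) with h | h
  · rw [huniq φ hφ _ _ (hf φ hφ) (.fire φ i _ h (hf _ hφ')), ← mul_assoc, coxeterGen_mul_self,
      one_mul]
  · refine huniq _ hφ' _ _ (hf _ hφ') (.fire _ i _ ?_ ?_)
    · rw [dotProduct_coordReflection, hdiag]
      linarith
    · rw [coordReflection_involutive M hdiag]
      exact hf φ hφ

end NumbersGame

/-! ### Reflection-stable finite sets of weights -/

section Weights

variable {I : Type*} (M : I → I → ℝ) (S : Finset (I → ℝ))

/-- The form `(i, j) ↦ ∑ π ∈ S, π i * π j` attached to a finite set of weights. -/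
def weightForm (i j : I) : ℝ := ∑ π ∈ S, π i * π j

theorem weightForm_comm (i j : I) :
    weightForm S i j = weightForm S j i :=
  Finset.sum_congr rfl fun _ _ => mul_comm _ _

theorem two_mul_weightForm (hdiag : ∀ i, M i i = 2)
    (hstab : ∀ i, ∀ π ∈ S, π - π i • M i ∈ S) (i j : I) :
    2 * weightForm S i j = M i j * weightForm S i i := by
  have hinv : ∀ π : I → ℝ, (π - π i • M i) - (π - π i • M i) i • M i = π := by
    intro π
    simp only [Pi.sub_apply, Pi.smul_apply, smul_eq_mul, hdiag]
    module
  have h : weightForm S i j = ∑ π ∈ S, (π - π i • M i) i * (π - π i • M i) j :=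
    Finset.sum_bij' (fun π _ => π - π i • M i) (fun π _ => π - π i • M i)
      (fun π hπ => hstab i π hπ) (fun π hπ => hstab i π hπ)
      (fun π _ => hinv π) (fun π _ => hinv π) (fun π _ => by rw [hinv])
  have h' : ∑ π ∈ S, (π - π i • M i) i * (π - π i • M i) j =
      - weightForm S i j + M i j * weightForm S i i := by
    simp only [weightForm, Finset.mul_sum, ← Finset.sum_neg_distrib, ← Finset.sum_add_distrib]
    refine Finset.sum_congr rfl fun π _ => ?_
    simp only [Pi.sub_apply, Pi.smul_apply, smul_eq_mul, hdiag]
    ring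
  linarith

theorem isFiniteTypePair_of_lt_four {a b : ℝ} (ha : ∃ k : ℤ, a = k) (hb : ∃ k : ℤ, b = k)
    (ha0 : a ≤ 0) (hb0 : b ≤ 0) (hab : a = 0 ↔ b = 0) (h4 : a * b < 4) :
    IsFiniteTypePair a b ∨ IsFiniteTypePair b a := by
  obtain ⟨k, rfl⟩ := ha
  obtain ⟨l, rfl⟩ := hb
  norm_cast at ha0 hb0 h4 hab
  have hcases : (k = 0 ∧ l = 0) ∨ (k = -1 ∧ l = -1) ∨ (k = -1 ∧ l = -2) ∨ (k = -1 ∧ l = -3) ∨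
      (l = -1 ∧ k = -2) ∨ (l = -1 ∧ k = -3) := by
    rcases eq_or_ne k 0 with hk | hk
    · exact Or.inl ⟨hk, hab.mp hk⟩
    have hl : l ≠ 0 := fun h => hk (hab.mpr h)
    have hk1 : k ≤ -1 := by omega
    have hl1 : l ≤ -1 := by omega
    have hk3 : -4 < k := by nlinarith
    have hl3 : -4 < l := by nlinarith
    interval_cases k <;> interval_cases l <;> simp_all
  unfold IsFiniteTypePair
  rcases hcases with ⟨rfl, rfl⟩ | ⟨rfl, rfl⟩ | ⟨rfl, rfl⟩ | ⟨rfl, rfl⟩ | ⟨rfl, rfl⟩ | ⟨rfl, rfl⟩ <;>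
    norm_num

variable [Fintype I]

theorem sum_weightForm_mul (φ : I → ℝ) :
    ∑ i, ∑ j, φ i * φ j * weightForm S i j = ∑ π ∈ S, (φ ⬝ᵥ π) ^ 2 := by
  have h : ∀ π : I → ℝ, (φ ⬝ᵥ π) ^ 2 = ∑ i, ∑ j, φ i * φ j * (π i * π j) := fun π => by
    rw [sq, dotProduct, Finset.sum_mul_sum]
    exact Finset.sum_congr rfl fun i _ => Finset.sum_congr rfl fun j _ => by ring
  simp only [h, weightForm, Finset.mul_sum]
  rw [Finset.sum_congr rfl fun i _ => Finset.sum_comm, Finset.sum_comm]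

theorem coordReflection_dotProduct (i : I) (φ π : I → ℝ) :
    coordReflection M i φ ⬝ᵥ π = φ ⬝ᵥ (π - π i • M i) := by
  classical
  simp only [coordReflection, sub_dotProduct, smul_dotProduct, single_dotProduct, dotProduct_sub,
    dotProduct_smul, smul_eq_mul, one_mul, dotProduct_comm φ (M i)]
  ring

/-- A finite set of weights separates the vectors of nonnegative coordinates from zero. -/
def SeparatesNonneg : Prop :=
  ∀ φ : I → ℝ, (∀ i, 0 ≤ φ i) → (∀ π ∈ S, φ ⬝ᵥ π = 0) → φ = 0

theorem SeparatesNonneg.weightForm_self_pos {S : Finset (I → ℝ)} (hS : SeparatesNonneg S)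
    (i : I) : 0 < weightForm S i i := by
  classical
  refine lt_of_le_of_ne (Finset.sum_nonneg fun π _ => mul_self_nonneg _) fun h => ?_
  have h0 := (Finset.sum_eq_zero_iff_of_nonneg fun π _ => mul_self_nonneg (π i)).mp h.symm
  have := congrFun (hS (Pi.single i 1) (fun k => by
    by_cases hk : k = i <;> simp [hk]) fun π hπ => by
      simpa using h0 π hπ) i
  simp at this

/-- If the off-diagonal entries of the weight form are nonpositive, separation of nonnegative
vectors upgrades to separation of all vectors. -/
theorem SeparatesNonneg.separates {S : Finset (I → ℝ)} (hS : SeparatesNonneg S)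
    (hK : ∀ i j, i ≠ j → weightForm S i j ≤ 0) {φ : I → ℝ} (hφ : ∀ π ∈ S, φ ⬝ᵥ π = 0) :
    φ = 0 := by
  have h0 : ∑ i, ∑ j, φ i * φ j * weightForm S i j = 0 := by
    rw [sum_weightForm_mul]
    exact Finset.sum_eq_zero fun π hπ => by rw [hφ π hπ]; simp
  have hle : ∑ i, ∑ j, |φ i| * |φ j| * weightForm S i j ≤
      ∑ i, ∑ j, φ i * φ j * weightForm S i j := by
    refine Finset.sum_le_sum fun i _ => Finset.sum_le_sum fun j _ => ?_
    rcases eq_or_ne i j with rfl | hij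
    · rw [abs_mul_abs_self]
    · rw [← abs_mul]
      exact mul_le_mul_of_nonpos_right (le_abs_self _) (hK i j hij)
  have habs := sum_weightForm_mul S (fun i => |φ i|)
  have hz := (Finset.sum_eq_zero_iff_of_nonneg fun π (_ : π ∈ S) =>
    sq_nonneg ((fun i => |φ i|) ⬝ᵥ π)).mp
      (le_antisymm (by linarith) (Finset.sum_nonneg fun π _ => sq_nonneg _))
  have := hS (fun i => |φ i|) (fun i => abs_nonneg _) fun π hπ => pow_eq_zero_iff two_ne_zero |>.mp
    (hz π hπ)
  funext i
  simpa using congrFun this i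

/-- An integral matrix with diagonal entries `2` and nonpositive off-diagonal entries, whose
reflections stabilize a separating finite set of weights, is a Cartan matrix of finite type. -/
theorem finiteType_of_stable_weights (hint : ∀ i j, ∃ k : ℤ, M i j = k)
    (hdiag : ∀ i, M i i = 2) (hnonpos : ∀ i j, i ≠ j → M i j ≤ 0)
    (hstab : ∀ i, ∀ π ∈ S, π - π i • M i ∈ S) (hS : SeparatesNonneg S) :
    (∀ i j, M i j = 0 ↔ M j i = 0) ∧ Finite (coxeterGroupOf M) := by
  classical
  have hpos := hS.weightForm_self_pos
  have hM := two_mul_weightForm M S hdiag hstab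
  have hK : ∀ i j, i ≠ j → weightForm S i j ≤ 0 := fun i j hij => by
    nlinarith [hM i j, hpos i, hnonpos i j hij]
  have hsep : ∀ φ : I → ℝ, (∀ π ∈ S, φ ⬝ᵥ π = 0) → φ = 0 := fun φ => hS.separates hK
  have hzero : ∀ i j, M i j = 0 → M j i = 0 := fun i j h => by
    have h1 := hM i j
    have h2 := hM j i
    rw [weightForm_comm S j i] at h2
    have : M j i * weightForm S j j = 0 := by rw [← h2, h1, h, zero_mul]
    exact (mul_eq_zero.mp this).resolve_right (hpos j).ne'
  have hsymm : ∀ i j, M i j = 0 ↔ M j i = 0 := fun i j => ⟨hzero i j, hzero j i⟩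
  have hfour : ∀ i j, i ≠ j → M i j * M j i < 4 := by
    intro i j hij
    have hcs : weightForm S i j ^ 2 < weightForm S i i * weightForm S j j := by
      set φ : I → ℝ := Pi.single i (weightForm S j j) - Pi.single j (weightForm S i j) with hφ
      have hval : ∑ π ∈ S, (φ ⬝ᵥ π) ^ 2 =
          weightForm S j j * (weightForm S i i * weightForm S j j - weightForm S i j ^ 2) := by
        have : ∀ π ∈ S, (φ ⬝ᵥ π) ^ 2 = weightForm S j j ^ 2 * (π i * π i)
            - 2 * weightForm S j j * weightForm S i j * (π i * π j)
            + weightForm S i j ^ 2 * (π j * π j) := fun π _ => by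
          simp only [hφ, sub_dotProduct, single_dotProduct]
          ring
        rw [Finset.sum_congr rfl this, Finset.sum_add_distrib, Finset.sum_sub_distrib,
          ← Finset.mul_sum, ← Finset.mul_sum, ← Finset.mul_sum]
        change _ * weightForm S i i - _ * weightForm S i j + _ * weightForm S j j = _
        ring
      have hne : φ ≠ 0 := fun h => by
        have := congrFun h i
        simp [hφ, hij, (hpos j).ne'] at this
      have : 0 < ∑ π ∈ S, (φ ⬝ᵥ π) ^ 2 := by
        refine lt_of_le_of_ne (Finset.sum_nonneg fun π _ => sq_nonneg _) fun h => hne ?_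
        exact hsep φ fun π hπ => pow_eq_zero_iff two_ne_zero |>.mp
          ((Finset.sum_eq_zero_iff_of_nonneg fun π _ => sq_nonneg _).mp h.symm π hπ)
      rw [hval] at this
      linarith [(mul_pos_iff_of_pos_left (hpos j)).mp this]
    have h1 := hM i j
    have h2 := hM j i
    rw [weightForm_comm S j i] at h2
    have hpp := mul_pos (hpos i) (hpos j)
    have : M i j * M j i * (weightForm S i i * weightForm S j j) =
        4 * weightForm S i j ^ 2 := by
      linear_combination (-M j i * weightForm S j j) * h1 - 2 * weightForm S i j * h2
    by_contra! hcon
    nlinarith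
  refine ⟨hsymm, ?_⟩
  -- A vector pairing to distinct values with distinct weights is regular.
  obtain ⟨φ₀, hφ₀⟩ : ∃ φ : I → ℝ, Set.InjOn (fun π => φ ⬝ᵥ π) S := by
    obtain ⟨f, hf⟩ := Module.exists_dual_forall_apply_ne_zero (K := ℝ)
      (fun p : {p : S × S // p.1 ≠ p.2} => (p.1.1 - p.1.2 : I → ℝ))
      fun p => sub_ne_zero.mpr fun h => p.2 (Subtype.ext h)
    refine ⟨fun i => f (Pi.single i 1), fun π hπ π' hπ' h => ?_⟩
    have hfdot : ∀ π : I → ℝ, (fun i => f (Pi.single i 1)) ⬝ᵥ π = f π := fun π => by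
      conv_rhs => rw [pi_eq_sum_univ' π]
      simp [dotProduct, mul_comm, Pi.single]
    by_contra hne
    refine hf ⟨(⟨π, hπ⟩, ⟨π', hπ'⟩), fun h => hne (Subtype.ext_iff.mp h)⟩ ?_
    simp only [hfdot] at h
    simp [h]
  refine finite_coxeterGroupOf_of_regular M hdiag
    (fun i j hij => isFiniteTypePair_of_lt_four (hint i j) (hint j i) (hnonpos i j hij)
      (hnonpos j i hij.symm) (hsymm i j) (hfour i j hij))
    {φ | Set.InjOn (fun π => φ ⬝ᵥ π) S ∧ ∀ π ∈ S, ∃ π' ∈ S, φ ⬝ᵥ π = φ₀ ⬝ᵥ π'}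
    ?_ ⟨φ₀, hφ₀, fun π hπ => ⟨π, hπ, rfl⟩⟩ ?_ ?_
  · refine Set.Finite.of_finite_image (f := fun φ (π : S) => φ ⬝ᵥ π.1) ?_ ?_
    · refine (Set.Finite.pi' (t := fun _ : S => (fun π => φ₀ ⬝ᵥ π) '' (S : Set (I → ℝ)))
        fun _ => S.finite_toSet.image _).subset ?_
      rintro _ ⟨φ, hφ, rfl⟩ π
      obtain ⟨π', hπ', h⟩ := hφ.2 π.1 π.2
      exact ⟨π', hπ', h.symm⟩
    · intro φ _ ψ _ h
      refine sub_eq_zero.mp (hsep _ fun π hπ => ?_)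
      have := congrFun h ⟨π, hπ⟩
      rw [sub_dotProduct]
      exact sub_eq_zero.mpr this
  · rintro i φ ⟨hinj, hval⟩
    refine ⟨fun π hπ π' hπ' h => ?_, fun π hπ => ?_⟩
    · simp only [coordReflection_dotProduct] at h
      have := hinj (hstab i π hπ) (hstab i π' hπ') h
      have hi := congrFun this i
      simp only [Pi.sub_apply, Pi.smul_apply, smul_eq_mul, hdiag] at hi
      have hi' : π i = π' i := by linarith
      rw [hi'] at this
      exact sub_left_injective this
    · rw [coordReflection_dotProduct]
      exact hval _ (hstab i π hπ)
  · rintro i φ ⟨hinj, -⟩ h0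
    refine (hpos i).ne' (Finset.sum_eq_zero fun π hπ => ?_)
    have h : φ ⬝ᵥ (π - π i • M i) = φ ⬝ᵥ π := by
      rw [dotProduct_sub, dotProduct_smul, dotProduct_comm φ (M i), h0, smul_zero, sub_zero]
    have := congrFun (hinj (hstab i π hπ) hπ h) i
    simp only [Pi.sub_apply, Pi.smul_apply, smul_eq_mul, hdiag] at this
    have : π i = 0 := by linarith
    rw [this, zero_mul]

end Weights

/-! ### Rank function of a finite distributive lattice -/

section Height

variable {V : Type*}

/-- There is a chain of `n` covering relations ending at `x`. -/
def HasCovChain [Preorder V] (n : ℕ) (x : V) : Prop :=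
  ∃ g : ℕ → V, g n = x ∧ ∀ k < n, g k ⋖ g (k + 1)

theorem HasCovChain.succ [Preorder V] {n : ℕ} {x y : V} (h : HasCovChain n x) (hxy : x ⋖ y) :
    HasCovChain (n + 1) y := by
  obtain ⟨g, rfl, hg⟩ := h
  refine ⟨fun k => if k ≤ n then g k else y, by simp, fun k hk => ?_⟩
  rcases (Nat.lt_succ_iff.mp hk).lt_or_eq with h | rfl
  · simpa [h.le, Nat.succ_le_of_lt h] using hg k h
  · simpa using hxy

theorem HasCovChain.exists_pred [Preorder V] {n : ℕ} {y : V} (h : HasCovChain (n + 1) y) :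
    ∃ x, HasCovChain n x ∧ x ⋖ y := by
  obtain ⟨g, rfl, hg⟩ := h
  exact ⟨g n, ⟨g, rfl, fun k hk => hg k (by omega)⟩, hg n (by omega)⟩

theorem HasCovChain.le_card [Preorder V] [Fintype V] {n : ℕ} {x : V} (h : HasCovChain n x) :
    n ≤ Fintype.card V := by
  classical
  suffices ∀ n, ∀ x : V, HasCovChain n x → n ≤ (Finset.univ.filter (· < x)).card from
    (this n x h).trans (Finset.card_le_univ _)
  intro n
  induction n with
  | zero => simp
  | succ n ih =>
    intro y hy
    obtain ⟨x, hx, hxy⟩ := hy.exists_pred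
    refine (Nat.succ_le_succ (ih x hx)).trans (Finset.card_lt_card ?_)
    refine Finset.ssubset_iff_of_subset (fun z hz => ?_) |>.mpr ⟨x, ?_⟩
    · simp only [Finset.mem_filter, Finset.mem_univ, true_and] at hz ⊢
      exact hz.trans hxy.lt
    · simpa using hxy.lt

theorem HasCovChain.le_heightOf [Preorder V] [Fintype V] {n : ℕ} {x : V}
    (h : HasCovChain n x) : n ≤ heightOf x :=
  le_csSup ⟨Fintype.card V, fun _ hm => HasCovChain.le_card hm⟩ h

theorem hasCovChain_heightOf [Preorder V] [Fintype V] (x : V) : HasCovChain (heightOf x) x :=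
  Nat.sSup_mem (s := {n | HasCovChain n x}) ⟨0, fun _ => x, rfl, by simp⟩
    ⟨Fintype.card V, fun _ hm => HasCovChain.le_card hm⟩

theorem HasCovChain.of_succ_of_covBy [DistribLattice V] {n : ℕ} {x y : V}
    (h : HasCovChain (n + 1) y) (hxy : x ⋖ y) : HasCovChain n x := by
  induction n generalizing x y with
  | zero => exact ⟨fun _ => x, rfl, by simp⟩
  | succ n ih =>
    obtain ⟨z, hz, hzy⟩ := h.exists_pred
    rcases eq_or_ne z x with rfl | hne
    · exact hz
    have hsup : z ⊔ x = y := WCovBy.sup_eq (CovBy.wcovBy hzy) (CovBy.wcovBy hxy) hne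
    have h₁ : z ⊓ x ⋖ z := inf_covBy_of_covBy_sup_right (by rwa [hsup])
    have h₂ : z ⊓ x ⋖ x := inf_covBy_of_covBy_sup_left (by rwa [hsup])
    exact (ih hz h₁).succ h₂

theorem heightOf_covBy [DistribLattice V] [Fintype V] {x y : V} (h : x ⋖ y) :
    heightOf y = heightOf x + 1 := by
  refine le_antisymm ?_ ((hasCovChain_heightOf x).succ h).le_heightOf
  rcases Nat.eq_zero_or_pos (heightOf y) with h0 | h0
  · omega
  · have hy := hasCovChain_heightOf y
    obtain ⟨n, hn⟩ : ∃ n, heightOf y = n + 1 := ⟨heightOf y - 1, by omega⟩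
    rw [hn] at hy
    have := (hy.of_succ_of_covBy h).le_heightOf
    omega

end Height

/-! ### Components of ranked relations with the diamond property -/

section Ranked

open Relation

variable {V : Type*} {r r' : V → V → Prop} {h : V → ℤ}

/-- In a component of a ranked relation with the diamond property, an upward path from any
element reaches the maximal rank. -/
theorem exists_reflTransGen_isMax [Finite V] (hrank : ∀ a b, r a b → h b = h a + 1)
    (hdia : ∀ x a b, r x a → r x b → a ≠ b → ∃ c, r a c ∧ r b c) (x : V) :
    ∃ t, ReflTransGen r x t ∧
      ∀ y, ReflTransGen (fun a b => r a b ∨ r b a) x y → h y ≤ h t := by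
  have hmono : ∀ a b, ReflTransGen r a b → h a ≤ h b := fun a b hab => by
    induction hab with
    | refl => exact le_rfl
    | tail _ hbc ih => have := hrank _ _ hbc; omega
  have hjoin : ∀ y, ReflTransGen (fun a b => r a b ∨ r b a) x y →
      ∃ z, ReflTransGen r x z ∧ ReflTransGen r y z := fun y hy => by
    induction hy with
    | refl => exact ⟨x, .refl, .refl⟩
    | @tail b c _ hbc ih =>
      obtain ⟨z, hxz, hbz⟩ := ih
      rcases hbc with hbc | hcb
      · obtain ⟨w, hzw, hcw⟩ := church_rosser (fun x a b hxa hxb => by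
          rcases eq_or_ne a b with rfl | hne
          · exact ⟨a, .refl, .refl⟩
          · obtain ⟨c, hac, hbc⟩ := hdia x a b hxa hxb hne
            exact ⟨c, .single hac, .single hbc⟩) hbz (ReflTransGen.single hbc)
        exact ⟨w, hxz.trans hzw, hcw⟩
      · exact ⟨z, hxz, .head hcb hbz⟩
  obtain ⟨m, hm, hmax⟩ := Set.exists_max_image
    {y | ReflTransGen (fun a b => r a b ∨ r b a) x y} h (Set.toFinite _) ⟨x, .refl⟩
  obtain ⟨z, hxz, hmz⟩ := hjoin m hm
  exact ⟨z, hxz, fun y hy => (hmax y hy).trans (hmono m z hmz)⟩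

/-- An upward path can be transported along a step of another ranked relation forming diamonds
with it. -/
theorem exists_reflTransGen_transport (hrank' : ∀ a b, r' a b → h b = h a + 1)
    (hdia : ∀ x a b, r x a → r' x b → ∃ c, r' a c ∧ r b c) {x y t : V} (hxy : r' x y)
    (hxt : ReflTransGen r x t) : ∃ z, ReflTransGen r y z ∧ h z = h t + 1 := by
  suffices ∃ z, ReflTransGen r y z ∧ r' t z by
    obtain ⟨z, hz, htz⟩ := this
    exact ⟨z, hz, hrank' _ _ htz⟩
  induction hxt with
  | refl => exact ⟨y, .refl, hxy⟩
  | tail _ hbc ih =>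
    obtain ⟨z, hyz, hbz⟩ := ih
    obtain ⟨w, hcw, hzw⟩ := hdia _ _ _ hbc hbz
    exact ⟨w, hyz.tail hzw, hcw⟩

end Ranked

namespace DiamondColoredDistribLattice

open Relation

variable {I : Type*} (L : DiamondColoredDistribLattice I)

theorem heightOf_edge {i : I} {x y : L.V} (h : L.edge i x y) : heightOf y = heightOf x + 1 :=
  heightOf_covBy (L.edge_cov i x y h)

theorem exists_diamond_up {i j : I} {x a b : L.V} (ha : L.edge i x a) (hb : L.edge j x b)
    (hne : a ≠ b) : ∃ c, L.edge j a c ∧ L.edge i b c := by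
  have hxa := L.edge_cov i x a ha
  have hxb := L.edge_cov j x b hb
  have hinf : a ⊓ b = x := WCovBy.inf_eq (CovBy.wcovBy hxa) (CovBy.wcovBy hxb) hne
  have hac : a ⋖ a ⊔ b := covBy_sup_of_inf_covBy_right (by rwa [hinf])
  have hbc : b ⋖ a ⊔ b := covBy_sup_of_inf_covBy_left (by rwa [hinf])
  exact ⟨a ⊔ b, (L.diamond j x b a _ hne.symm hxb hxa hbc hac).mp hb,
    (L.diamond i x a b _ hne hxa hxb hac hbc).mp ha⟩

theorem exists_diamond_down {i j : I} {x a b : L.V} (ha : L.edge i a x) (hb : L.edge j b x)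
    (hne : a ≠ b) : ∃ c, L.edge j c a ∧ L.edge i c b := by
  have hax := L.edge_cov i a x ha
  have hbx := L.edge_cov j b x hb
  have hsup : a ⊔ b = x := WCovBy.sup_eq (CovBy.wcovBy hax) (CovBy.wcovBy hbx) hne
  have hca : a ⊓ b ⋖ a := inf_covBy_of_covBy_sup_right (by rwa [hsup])
  have hcb : a ⊓ b ⋖ b := inf_covBy_of_covBy_sup_left (by rwa [hsup])
  exact ⟨a ⊓ b, (L.diamond j _ a b x hne hca hcb hax hbx).mpr hb,
    (L.diamond i _ b a x hne.symm hcb hca hbx hax).mpr ha⟩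

theorem comp_eq_of_edge {i : I} {x y : L.V} (h : L.edge i x y) : L.comp i x = L.comp i y :=
  Set.ext fun _ => ⟨fun hz => .head (Or.inr h) hz, fun hz => .head (Or.inl h) hz⟩

theorem self_mem_comp (i : I) (x : L.V) : x ∈ L.comp i x := ReflTransGen.refl

theorem mem_comp_of_path_up {i : I} {x t : L.V} (h : ReflTransGen (L.edge i) x t) :
    t ∈ L.comp i x := ReflTransGen.mono (fun _ _ => Or.inl) _ _ h

theorem mem_comp_of_path_down {i : I} {x t : L.V}
    (h : ReflTransGen (fun a b => L.edge i b a) x t) : t ∈ L.comp i x :=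
  ReflTransGen.mono (fun _ _ => Or.inr) _ _ h

theorem heightOf_le_add_deltai {i : I} {x y : L.V} (hy : y ∈ L.comp i x) :
    heightOf y ≤ heightOf x + L.deltai i x := by
  have hb := (Set.toFinite (heightOf '' L.comp i x)).bddAbove
  have h₁ := le_csSup hb (Set.mem_image_of_mem _ hy)
  have h₂ := le_csSup hb (Set.mem_image_of_mem _ (L.self_mem_comp i x))
  have h₃ := Nat.sInf_le (Set.mem_image_of_mem heightOf (L.self_mem_comp i x))
  simp only [deltai, li, rhoi]
  omega

theorem heightOf_le_add_rhoi {i : I} {x y : L.V} (hy : y ∈ L.comp i x) :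
    heightOf x ≤ heightOf y + L.rhoi i x := by
  have h₁ := Nat.sInf_le (Set.mem_image_of_mem heightOf hy)
  simp only [rhoi]
  omega

theorem exists_top (i : I) (x : L.V) :
    ∃ t, ReflTransGen (L.edge i) x t ∧ heightOf t = heightOf x + L.deltai i x := by
  obtain ⟨t, hxt, hmax⟩ := exists_reflTransGen_isMax (r := L.edge i)
    (h := fun v => (heightOf v : ℤ)) (fun a b hab => by simp [L.heightOf_edge hab])
    (fun x a b ha hb hne => L.exists_diamond_up ha hb hne) x
  refine ⟨t, hxt, le_antisymm (L.heightOf_le_add_deltai (L.mem_comp_of_path_up hxt)) ?_⟩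
  have h₁ : sSup (heightOf '' L.comp i x) ≤ heightOf t :=
    csSup_le ⟨_, Set.mem_image_of_mem _ (L.self_mem_comp i x)⟩ (by
      rintro _ ⟨y, hy, rfl⟩
      exact_mod_cast hmax y hy)
  have h₂ : heightOf x ≤ heightOf t := by exact_mod_cast hmax x .refl
  have h₃ := Nat.sInf_le (Set.mem_image_of_mem heightOf (L.self_mem_comp i x))
  simp only [deltai, li, rhoi]
  omega

theorem exists_bottom (i : I) (x : L.V) :
    ∃ t, ReflTransGen (fun a b => L.edge i b a) x t ∧ heightOf x = heightOf t + L.rhoi i x := by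
  obtain ⟨t, hxt, hmax⟩ := exists_reflTransGen_isMax (r := fun a b => L.edge i b a)
    (h := fun v => -(heightOf v : ℤ)) (fun a b hab => by simp [L.heightOf_edge hab])
    (fun x a b ha hb hne => L.exists_diamond_down ha hb hne) x
  refine ⟨t, hxt, le_antisymm (L.heightOf_le_add_rhoi (L.mem_comp_of_path_down hxt)) ?_⟩
  have hmax' : ∀ y ∈ L.comp i x, heightOf t ≤ heightOf y := fun y hy => by
    have := hmax y (ReflTransGen.mono (fun _ _ => Or.symm) _ _ hy)
    omega
  have h₁ : heightOf t ≤ sInf (heightOf '' L.comp i x) :=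
    le_csInf ⟨_, Set.mem_image_of_mem _ (L.self_mem_comp i x)⟩ (by
      rintro _ ⟨y, hy, rfl⟩
      exact hmax' y hy)
  have h₂ := hmax' x (L.self_mem_comp i x)
  simp only [rhoi]
  omega

theorem rhoi_edge {i : I} {x y : L.V} (h : L.edge i x y) : L.rhoi i y = L.rhoi i x + 1 := by
  have h₃ := Nat.sInf_le (Set.mem_image_of_mem heightOf (L.self_mem_comp i x))
  have := L.heightOf_edge h
  simp only [rhoi, ← L.comp_eq_of_edge h]
  omega

theorem deltai_edge {i : I} {x y : L.V} (h : L.edge i x y) :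
    L.deltai i x = L.deltai i y + 1 := by
  have hy := L.heightOf_edge h
  have hyx : y ∈ L.comp i x := L.comp_eq_of_edge h ▸ L.self_mem_comp i y
  have h₁ := le_csSup (Set.toFinite (heightOf '' L.comp i x)).bddAbove
    (Set.mem_image_of_mem _ hyx)
  have h₂ := Nat.sInf_le (Set.mem_image_of_mem heightOf (L.self_mem_comp i x))
  simp only [deltai, li, rhoi, ← L.comp_eq_of_edge h]
  omega

theorem mi_edge {i : I} {x y : L.V} (h : L.edge i x y) : L.mi i y = L.mi i x + 2 := by
  have := L.rhoi_edge h
  have := L.deltai_edge h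
  simp only [mi]
  omega

theorem exists_edge_of_deltai_pos {i : I} {x : L.V} (h : 0 < L.deltai i x) :
    ∃ y, L.edge i x y := by
  obtain ⟨t, hxt, ht⟩ := L.exists_top i x
  rcases hxt.cases_head with rfl | ⟨y, hy, -⟩
  · omega
  · exact ⟨y, hy⟩

theorem exists_edge_of_rhoi_pos {i : I} {x : L.V} (h : 0 < L.rhoi i x) :
    ∃ y, L.edge i y x := by
  obtain ⟨t, hxt, ht⟩ := L.exists_bottom i x
  rcases hxt.cases_head with rfl | ⟨y, hy, -⟩
  · omega
  · exact ⟨y, hy⟩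

theorem deltai_le_of_edge {i j : I} (hij : i ≠ j) {x y : L.V} (h : L.edge i x y) :
    L.deltai j x ≤ L.deltai j y := by
  obtain ⟨t, hxt, ht⟩ := L.exists_top j x
  obtain ⟨z, hyz, hz⟩ := exists_reflTransGen_transport (r := L.edge j) (r' := L.edge i)
    (h := fun v => (heightOf v : ℤ)) (fun a b hab => by simp [L.heightOf_edge hab])
    (fun x a b ha hb => L.exists_diamond_up ha hb fun hab =>
      hij (L.edge_unique i j x b hb (hab ▸ ha))) h hxt
  have := L.heightOf_le_add_deltai (L.mem_comp_of_path_up hyz)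
  have := L.heightOf_edge h
  omega

theorem rhoi_le_of_edge {i j : I} (hij : i ≠ j) {x y : L.V} (h : L.edge i x y) :
    L.rhoi j y ≤ L.rhoi j x := by
  obtain ⟨t, hyt, ht⟩ := L.exists_bottom j y
  obtain ⟨z, hxz, hz⟩ := exists_reflTransGen_transport (r := fun a b => L.edge j b a)
    (r' := fun a b => L.edge i b a)
    (h := fun v => -(heightOf v : ℤ)) (fun a b hab => by simp [L.heightOf_edge hab])
    (fun x a b ha hb => L.exists_diamond_down ha hb fun hab =>
      hij (L.edge_unique i j b x hb (hab ▸ ha))) h hyt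
  have := L.heightOf_le_add_rhoi (L.mem_comp_of_path_down hxz)
  have := L.heightOf_edge h
  omega

theorem mi_le_of_edge {i j : I} (hij : i ≠ j) {x y : L.V} (h : L.edge i x y) :
    L.mi j y ≤ L.mi j x := by
  have := L.deltai_le_of_edge hij h
  have := L.rhoi_le_of_edge hij h
  simp only [mi]
  omega

/-- The weight of a lattice element. -/
def wt (x : L.V) : I → ℝ := fun j => (L.mi j x : ℝ)

theorem wt_edge (M : I → I → ℝ)
    (hM : ∀ (i : I) (x y : L.V), L.edge i x y → ∀ j : I, (L.mi j x : ℝ) + M i j = (L.mi j y : ℝ))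
    {i : I} {x y : L.V} (h : L.edge i x y) : L.wt y = L.wt x + M i :=
  funext fun j => (hM i x y h j).symm

theorem exists_wt_add (M : I → I → ℝ)
    (hM : ∀ (i : I) (x y : L.V), L.edge i x y → ∀ j : I, (L.mi j x : ℝ) + M i j = (L.mi j y : ℝ))
    (i : I) (n : ℕ) (x : L.V) (hn : n ≤ L.deltai i x) :
    ∃ y, L.wt y = L.wt x + (n : ℝ) • M i := by
  induction n generalizing x with
  | zero => exact ⟨x, by simp⟩
  | succ n ih =>
    obtain ⟨z, hz⟩ := L.exists_edge_of_deltai_pos (by omega : 0 < L.deltai i x)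
    have := L.deltai_edge hz
    obtain ⟨y, hy⟩ := ih z (by omega)
    refine ⟨y, ?_⟩
    rw [hy, L.wt_edge M hM hz]
    push_cast
    module

theorem exists_wt_sub (M : I → I → ℝ)
    (hM : ∀ (i : I) (x y : L.V), L.edge i x y → ∀ j : I, (L.mi j x : ℝ) + M i j = (L.mi j y : ℝ))
    (i : I) (n : ℕ) (x : L.V) (hn : n ≤ L.rhoi i x) :
    ∃ y, L.wt y = L.wt x - (n : ℝ) • M i := by
  induction n generalizing x with
  | zero => exact ⟨x, by simp⟩
  | succ n ih =>
    obtain ⟨z, hz⟩ := L.exists_edge_of_rhoi_pos (by omega : 0 < L.rhoi i x)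
    have := L.rhoi_edge hz
    obtain ⟨y, hy⟩ := ih z (by omega)
    refine ⟨y, ?_⟩
    rw [hy, L.wt_edge M hM hz]
    push_cast
    module

theorem exists_wt_reflection (M : I → I → ℝ)
    (hM : ∀ (i : I) (x y : L.V), L.edge i x y → ∀ j : I, (L.mi j x : ℝ) + M i j = (L.mi j y : ℝ))
    (i : I) (x : L.V) : ∃ y, L.wt y = L.wt x - L.wt x i • M i := by
  rcases le_total (L.deltai i x) (L.rhoi i x) with h | h
  · obtain ⟨y, hy⟩ := L.exists_wt_sub M hM i (L.rhoi i x - L.deltai i x) x (Nat.sub_le _ _)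
    refine ⟨y, ?_⟩
    rw [hy]
    simp [wt, mi, Nat.cast_sub h]
  · obtain ⟨y, hy⟩ := L.exists_wt_add M hM i (L.deltai i x - L.rhoi i x) x (Nat.sub_le _ _)
    refine ⟨y, ?_⟩
    rw [hy]
    simp only [wt, mi, Nat.cast_sub h]
    push_cast
    module

/-- A nonnegative vector orthogonal to all weights of a lattice with surjective coloring is
zero. -/
theorem eq_zero_of_dotProduct_wt_eq_zero [Fintype I] (hsurj : ∀ i : I, ∃ x y : L.V, L.edge i x y)
    (φ : I → ℝ) (hφ : ∀ i, 0 ≤ φ i) (h0 : ∀ x, φ ⬝ᵥ L.wt x = 0) : φ = 0 := by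
  have key : ∀ x y : L.V, ∀ j, 0 < φ j → ¬ L.edge j x y := by
    intro x
    induction x using (Finite.wellFounded_of_trans_of_irrefl
      (· > · : L.V → L.V → Prop)).induction with
    | _ x ih =>
      intro y j hj hxy
      have hy := ih y (L.edge_cov j x y hxy).lt
      have hδ : ∀ k, 0 < φ k → L.deltai k y = 0 := fun k hk => by
        by_contra hne
        obtain ⟨z, hz⟩ := L.exists_edge_of_deltai_pos (Nat.pos_of_ne_zero hne)
        exact hy z k hk hz
      have hnonneg : ∀ k, 0 ≤ φ k * L.wt y k := fun k => by
        rcases (hφ k).eq_or_lt with hk | hk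
        · simp [← hk]
        · simpa [wt, mi, hδ k hk] using
            mul_nonneg hk.le (Nat.cast_nonneg (α := ℝ) (L.rhoi k y))
      have hjz := (Finset.sum_eq_zero_iff_of_nonneg fun k _ => hnonneg k).mp (h0 y) j
        (Finset.mem_univ j)
      have hρ := L.rhoi_edge hxy
      rcases mul_eq_zero.mp hjz with h | h
      · exact hj.ne' h
      · simp [wt, mi, hδ j hj, hρ] at h
        have := Nat.cast_nonneg (α := ℝ) (L.rhoi j x)
        linarith
  funext i
  obtain ⟨x, y, hxy⟩ := hsurj i
  rcases (hφ i).eq_or_lt with h | h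
  · exact h.symm
  · exact absurd hxy (key x y i h)

end DiamondColoredDistribLattice

/-- **Theorem B.13 / Corollary B.14**:  if a diamond-colored distributive lattice `L` has a
surjective edge-coloring by `I` and the `M`-structure property for a real matrix `M`,
then `M` is a generalized Cartan matrix; moreover `M` is then a Cartan matrix of finite
type, i.e. the associated Coxeter group `W_M` is finite. -/
theorem statement18 {I : Type*} [Fintype I] (M : I → I → ℝ)
    (L : DiamondColoredDistribLattice I)
    (hsurj : ∀ i : I, ∃ x y : L.V, L.edge i x y)
    (hM : ∀ (i : I) (x y : L.V), L.edge i x y →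
      ∀ j : I, (L.mi j x : ℝ) + M i j = (L.mi j y : ℝ)) :
    (∀ i j : I, ∃ k : ℤ, M i j = (k : ℝ)) ∧
    (∀ i : I, M i i = 2) ∧
    (∀ i j : I, i ≠ j → M i j ≤ 0) ∧
    (∀ i j : I, (M i j = 0 ↔ M j i = 0)) ∧
    Finite (coxeterGroupOf M) := by
  classical
  have hdiag : ∀ i, M i i = 2 := fun i => by
    obtain ⟨x, y, hxy⟩ := hsurj i
    have h := hM i x y hxy i
    rw [L.mi_edge hxy] at h
    push_cast at h
    linarith
  have hint : ∀ i j, ∃ k : ℤ, M i j = k := fun i j => by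
    obtain ⟨x, y, hxy⟩ := hsurj i
    exact ⟨L.mi j y - L.mi j x, by push_cast; linarith [hM i x y hxy j]⟩
  have hnonpos : ∀ i j, i ≠ j → M i j ≤ 0 := fun i j hij => by
    obtain ⟨x, y, hxy⟩ := hsurj i
    have h : (L.mi j y : ℝ) ≤ L.mi j x := by exact_mod_cast L.mi_le_of_edge hij hxy
    linarith [hM i x y hxy j]
  obtain ⟨hsymm, hfin⟩ := finiteType_of_stable_weights M (Finset.univ.image L.wt) hint hdiag
    hnonpos (fun i π hπ => by
      obtain ⟨x, -, rfl⟩ := Finset.mem_image.mp hπ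
      obtain ⟨y, hy⟩ := L.exists_wt_reflection M hM i x
      exact Finset.mem_image.mpr ⟨y, Finset.mem_univ y, hy⟩)
    (fun φ hφ h => L.eq_zero_of_dotProduct_wt_eq_zero hsurj φ hφ fun x =>
      h _ (Finset.mem_image_of_mem _ (Finset.mem_univ x)))
  exact ⟨hint, hdiag, hnonpos, hsymm, hfin⟩
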